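/- arXiv:1605.06901 — 8 statements merged into one kernel-verified Lean document; each statement's English description precedes it below -/
import Mathlib

section
/- There exists a Lie algebra homomorphism φ from 𝓗 to 𝓕 such that φ(e₁') = E₁, φ(e₂') = E₂, φ(f₁') = F₁, φ(f₂') = F₂, φ(h₁') = H₁, and φ(h₂') = H₂, where e₁',e₂',f₁',f₂',h₁',h₂' denote the Serre generators of 𝓗. (In other words, E₁, E₂, F₁, F₂, H₁, H₂ satisfy all the Serre relations of the rank 2 hyperbolic Cartan matrix B inside 𝓕.) -/
/-!
Statement 0: There exists a Lie algebra homomorphism φ from 𝓗 (the Serre-presented Lie algebra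
of the rank 2 hyperbolic Cartan matrix B = !![2,-3;-3,2]) to 𝓕 (the Serre-presented Lie algebra
of the rank 3 Cartan matrix A = !![2,-2,0;-2,2,-1;0,-1,2]) sending the Serre generators of 𝓗 to
E₁, E₂, F₁, F₂, H₁, H₂ respectively.
-/

noncomputable section

open CartanMatrix

/-- The generalized Cartan matrix of the rank 3 hyperbolic Kac-Moody algebra 𝓕. -/
def Amat : Matrix (Fin 3) (Fin 3) ℤ := !![2, -2, 0; -2, 2, -1; 0, -1, 2]

/-- The rank 3 hyperbolic Kac-Moody algebra 𝓕 over ℚ. -/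
abbrev 𝓕 : Type := Matrix.ToLieAlgebra ℚ Amat

/-- The Chevalley generator eᵢ of 𝓕 (index `i : Fin 3`, with `e 0 = e₁`, etc.). -/
def e (i : Fin 3) : 𝓕 :=
  LieSubmodule.Quotient.mk (N := Relations.toIdeal ℚ Amat)
    (FreeLieAlgebra.of ℚ (Generators.E i))

/-- The Chevalley generator fᵢ of 𝓕. -/
def f (i : Fin 3) : 𝓕 :=
  LieSubmodule.Quotient.mk (N := Relations.toIdeal ℚ Amat)
    (FreeLieAlgebra.of ℚ (Generators.F i))

/-- The Chevalley generator hᵢ of 𝓕. -/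
def h (i : Fin 3) : 𝓕 :=
  LieSubmodule.Quotient.mk (N := Relations.toIdeal ℚ Amat)
    (FreeLieAlgebra.of ℚ (Generators.H i))

/-- E₁ := (1/2)•⁅e₁,⁅e₁,⁅e₂,e₃⁆⁆⁆. -/
def E₁ : 𝓕 := (1/2 : ℚ) • ⁅e 0, ⁅e 0, ⁅e 1, e 2⁆⁆⁆

/-- E₂ := e₂. -/
def E₂ : 𝓕 := e 1

/-- F₁ := -(1/2)•⁅f₁,⁅f₁,⁅f₂,f₃⁆⁆⁆. -/
def F₁ : 𝓕 := -((1/2 : ℚ) • ⁅f 0, ⁅f 0, ⁅f 1, f 2⁆⁆⁆)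

/-- F₂ := f₂. -/
def F₂ : 𝓕 := f 1

/-- H₁ := 2h₁ + h₂ + h₃. -/
def H₁ : 𝓕 := (2 : ℚ) • h 0 + h 1 + h 2

/-- H₂ := h₂. -/
def H₂ : 𝓕 := h 1

/-- The generalized Cartan matrix of the rank 2 hyperbolic (Fibonacci) Kac-Moody algebra. -/
def Bmat : Matrix (Fin 2) (Fin 2) ℤ := !![2, -3; -3, 2]

/-- The rank 2 hyperbolic Kac-Moody algebra 𝓗 = 𝓗(3) over ℚ. -/
abbrev 𝓗 : Type := Matrix.ToLieAlgebra ℚ Bmat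

/-- The Serre generator eᵢ' of 𝓗. -/
def e' (i : Fin 2) : 𝓗 :=
  LieSubmodule.Quotient.mk (N := Relations.toIdeal ℚ Bmat)
    (FreeLieAlgebra.of ℚ (Generators.E i))

/-- The Serre generator fᵢ' of 𝓗. -/
def f' (i : Fin 2) : 𝓗 :=
  LieSubmodule.Quotient.mk (N := Relations.toIdeal ℚ Bmat)
    (FreeLieAlgebra.of ℚ (Generators.F i))

/-- The Serre generator hᵢ' of 𝓗. -/
def h' (i : Fin 2) : 𝓗 :=
  LieSubmodule.Quotient.mk (N := Relations.toIdeal ℚ Bmat)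
    (FreeLieAlgebra.of ℚ (Generators.H i))

open LieAlgebra

/-- Families `h`, `e`, `f` in a Lie algebra satisfying the Serre relations of the matrix `A`. -/
structure IsSerreFamily (R : Type*) {B L : Type*} [CommRing R] [LieRing L] [LieAlgebra R L]
    (A : Matrix B B ℤ) (h e f : B → L) : Prop where
  lie_h_h : ∀ i j, ⁅h i, h j⁆ = 0
  lie_e_f_self : ∀ i, ⁅e i, f i⁆ = h i
  lie_e_f_of_ne : ∀ i j, i ≠ j → ⁅e i, f j⁆ = 0
  lie_h_e : ∀ i j, ⁅h i, e j⁆ = A i j • e j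
  lie_h_f : ∀ i j, ⁅h i, f j⁆ = -(A i j • f j)
  ad_e_pow : ∀ i j, ((ad R L (e i)) ^ (-A i j).toNat) ⁅e i, e j⁆ = 0
  ad_f_pow : ∀ i j, ((ad R L (f i)) ^ (-A i j).toNat) ⁅f i, f j⁆ = 0

theorem LieHom.map_ad_pow_apply {R L L' : Type*} [CommRing R] [LieRing L] [LieAlgebra R L]
    [LieRing L'] [LieAlgebra R L'] (φ : L →ₗ⁅R⁆ L') (x y : L) (n : ℕ) :
    φ ((ad R L x ^ n) y) = (ad R L' (φ x) ^ n) (φ y) := by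
  induction n with
  | zero => simp
  | succ n ih => simp only [pow_succ', Module.End.mul_apply, ad_apply, LieHom.map_lie, ih]

section Presentation

variable {R B L : Type*} [CommRing R] [DecidableEq B] [LieRing L] [LieAlgebra R L]

/-- The projection from the free Lie algebra onto the Serre-presented Lie algebra. -/
def Matrix.toLieAlgebraMk (R : Type*) [CommRing R] (A : Matrix B B ℤ) :
    FreeLieAlgebra R (Generators B) →ₗ⁅R⁆ Matrix.ToLieAlgebra R A :=
  { (Relations.toIdeal R A).toSubmodule.mkQ with
    map_lie' := by intros; rfl }

theorem Matrix.toLieAlgebraMk_eq_zero {A : Matrix B B ℤ} {x : FreeLieAlgebra R (Generators B)}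
    (hx : x ∈ Relations.toSet R A) : A.toLieAlgebraMk R x = 0 :=
  (LieSubmodule.Quotient.mk_eq_zero' (N := Relations.toIdeal R A)).2
    (LieSubmodule.subset_lieSpan hx)

theorem Matrix.isSerreFamily_toLieAlgebraMk (A : Matrix B B ℤ) :
    IsSerreFamily R A
      (fun i => A.toLieAlgebraMk R (FreeLieAlgebra.of R (Generators.H i)))
      (fun i => A.toLieAlgebraMk R (FreeLieAlgebra.of R (Generators.E i)))
      (fun i => A.toLieAlgebraMk R (FreeLieAlgebra.of R (Generators.F i))) where
  lie_h_h i j := by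
    have := A.toLieAlgebraMk_eq_zero (R := R) (x := Relations.HH R (i, j))
      (by simp [Relations.toSet])
    simpa [Relations.HH] using this
  lie_e_f_self i := by
    have := A.toLieAlgebraMk_eq_zero (R := R) (x := Relations.EF R (i, i))
      (by simp only [Relations.toSet, Set.mem_union, Set.mem_range_self, true_or, or_true])
    simpa [Relations.EF, sub_eq_zero] using this
  lie_e_f_of_ne i j hij := by
    have := A.toLieAlgebraMk_eq_zero (R := R) (x := Relations.EF R (i, j))
      (by simp only [Relations.toSet, Set.mem_union, Set.mem_range_self, true_or, or_true])
    simpa [Relations.EF, hij] using this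
  lie_h_e i j := by
    have := A.toLieAlgebraMk_eq_zero (R := R) (x := Relations.HE R A (i, j))
      (by simp only [Relations.toSet, Set.mem_union, Set.mem_range_self, true_or, or_true])
    simpa [Relations.HE, sub_eq_zero] using this
  lie_h_f i j := by
    have := A.toLieAlgebraMk_eq_zero (R := R) (x := Relations.HF R A (i, j))
      (by simp only [Relations.toSet, Set.mem_union, Set.mem_range_self, true_or, or_true])
    simpa [Relations.HF, add_eq_zero_iff_eq_neg] using this
  ad_e_pow i j := by
    have := A.toLieAlgebraMk_eq_zero (R := R) (x := Relations.adE R A (i, j))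
      (by simp only [Relations.toSet, Set.mem_union, Set.mem_range_self, true_or, or_true])
    simpa [Relations.adE, LieHom.map_ad_pow_apply] using this
  ad_f_pow i j := by
    have := A.toLieAlgebraMk_eq_zero (R := R) (x := Relations.adF R A (i, j))
      (by simp only [Relations.toSet, Set.mem_union, Set.mem_range_self, or_true])
    simpa [Relations.adF, LieHom.map_ad_pow_apply] using this

theorem IsSerreFamily.exists_lieHom {A : Matrix B B ℤ} {h e f : B → L}
    (hS : IsSerreFamily R A h e f) :
    ∃ φ : Matrix.ToLieAlgebra R A →ₗ⁅R⁆ L,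
      (∀ i, φ (A.toLieAlgebraMk R (FreeLieAlgebra.of R (Generators.H i))) = h i) ∧
      (∀ i, φ (A.toLieAlgebraMk R (FreeLieAlgebra.of R (Generators.E i))) = e i) ∧
      (∀ i, φ (A.toLieAlgebraMk R (FreeLieAlgebra.of R (Generators.F i))) = f i) := by
  let g : Generators B → L
    | .H i => h i
    | .E i => e i
    | .F i => f i
  let ψ := FreeLieAlgebra.lift R g
  have hψ (x : Generators B) : ψ (FreeLieAlgebra.of R x) = g x := FreeLieAlgebra.lift_of_apply g x
  have hker : Relations.toIdeal R A ≤ ψ.ker := by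
    refine LieSubmodule.lieSpan_le.2 ?_
    rintro x (((((⟨⟨i, j⟩, rfl⟩ | ⟨⟨i, j⟩, rfl⟩) | ⟨⟨i, j⟩, rfl⟩) | ⟨⟨i, j⟩, rfl⟩) |
      ⟨⟨i, j⟩, rfl⟩) | ⟨⟨i, j⟩, rfl⟩) <;> simp only [SetLike.mem_coe, LieHom.mem_ker]
    · simpa [Relations.HH, hψ, g] using hS.lie_h_h i j
    · by_cases hij : i = j
      · subst hij
        simpa [Relations.EF, hψ, g, sub_eq_zero] using hS.lie_e_f_self i
      · simpa [Relations.EF, hij, hψ, g] using hS.lie_e_f_of_ne i j hij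
    · simpa [Relations.HE, hψ, g, sub_eq_zero] using hS.lie_h_e i j
    · simpa [Relations.HF, hψ, g, add_eq_zero_iff_eq_neg] using hS.lie_h_f i j
    · simpa [Relations.adE, LieHom.map_ad_pow_apply, hψ, g] using hS.ad_e_pow i j
    · simpa [Relations.adF, LieHom.map_ad_pow_apply, hψ, g] using hS.ad_f_pow i j
  let φ : Matrix.ToLieAlgebra R A →ₗ⁅R⁆ L :=
    { Submodule.liftQ (Relations.toIdeal R A).toSubmodule
        (ψ : FreeLieAlgebra R (Generators B) →ₗ[R] L) hker with
      map_lie' := by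
        rintro ⟨x⟩ ⟨y⟩
        exact ψ.map_lie x y }
  exact ⟨φ, fun i => hψ (.H i), fun i => hψ (.E i), fun i => hψ (.F i)⟩

end Presentation

section Nilpotency

variable {K L : Type*} [Field K] [LieRing L] [LieAlgebra K L]

/-- If `v` is a lowest weight vector of weight `-n` for an `sl₂`-triple whose raising operator
is nilpotent on `v`, then `n + 1` applications of the raising operator kill `v`. -/
theorem LieAlgebra.ad_pow_succ_apply_eq_zero_of_mem_engel [CharZero K] {x y t v : L} {n : ℕ}
    (hxy : ⁅x, y⁆ = t) (htx : ⁅t, x⁆ = 2 • x) (hty : ⁅t, y⁆ = -(2 • y))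
    (htv : ⁅t, v⁆ = -((n : K) • v)) (hyv : ⁅y, v⁆ = 0) (hv : v ∈ LieSubalgebra.engel K x) :
    (ad K L x ^ (n + 1)) v = 0 := by
  by_cases ht : t = 0
  · have : x = 0 := by simpa [ht, ← Nat.cast_smul_eq_nsmul K] using htx.symm
    simp [this]
  by_cases hv0 : v = 0
  · simp [hv0]
  have sl2 : IsSl2Triple (-t) y x := IsSl2Triple.symm ⟨ht, hxy, htx, hty⟩
  have P : sl2.HasPrimitiveVectorWith v (n : K) := ⟨hv0, by simp [htv], hyv⟩
  obtain ⟨N, hN⟩ := (LieSubalgebra.mem_engel_iff K x v).1 hv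
  suffices ∀ m, (ad K L x ^ (n + 1 + m)) v = 0 → (ad K L x ^ (n + 1)) v = 0 by
    refine this N ?_
    rw [pow_add, Module.End.mul_apply, hN, map_zero]
  intro m
  induction m with
  | zero => exact id
  | succ m ih =>
    intro hm
    apply ih
    have := P.lie_e_pow_succ_toEnd_f (n + 1 + m)
    change ⁅y, (ad K L x ^ (n + 1 + (m + 1))) v⁆ = _ • (ad K L x ^ (n + 1 + m)) v at this
    rw [hm, lie_zero, eq_comm, smul_eq_zero] at this
    refine this.resolve_left (mul_ne_zero (Nat.cast_add_one_ne_zero _) ?_)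
    push_cast
    have : (m : K) + 1 ≠ 0 := Nat.cast_add_one_ne_zero m
    contrapose this
    linear_combination -this

theorem LieSubalgebra.engel_le_engel_smul (c : K) (x : L) :
    LieSubalgebra.engel K x ≤ LieSubalgebra.engel K (c • x) := by
  intro y hy
  rw [LieSubalgebra.mem_engel_iff] at hy ⊢
  obtain ⟨n, hn⟩ := hy
  exact ⟨n, by simp [smul_pow, hn]⟩

end Nilpotency

section Brackets

variable {L : Type*} [LieRing L] [LieAlgebra ℚ L] {d a b c : L}

theorem lie_lie_top_eq_zero (hb : ⁅d, a⁆ = b) (hc : ⁅d, b⁆ = c) (hd : ⁅d, c⁆ = 0)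
    (hw : ⁅a, ⁅a, ⁅a, d⁆⁆⁆ = 0) : ⁅c, ⁅c, b⁆⁆ = 0 := by
  have h0 : ⁅a, ⁅a, b⁆⁆ = 0 := by
    rw [← lie_skew a d, hb, lie_neg, lie_neg, neg_eq_zero] at hw
    exact hw
  have h4 : ⁅d, ⁅d, ⁅d, ⁅d, ⁅a, ⁅a, b⁆⁆⁆⁆⁆⁆ = 0 := by simp [h0]
  simp only [leibniz_lie d, lie_add, hb, hc, hd, lie_self, zero_lie, lie_zero, zero_add, add_zero] at h4
  rw [← lie_skew b c, lie_neg] at h4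
  have : (6 : ℚ) • ⁅c, ⁅c, b⁆⁆ = 0 := by
    rw [← neg_eq_zero, ← h4]
    module
  simpa using this

theorem lie_top_top_eq_zero {p q r : L} (hb : ⁅d, a⁆ = b) (hc : ⁅d, b⁆ = c) (hd : ⁅d, c⁆ = 0)
    (hq : ⁅d, p⁆ = q) (hr : ⁅d, q⁆ = r) (hdr : ⁅d, r⁆ = 0) (hw : ⁅a, p⁆ = 0) : ⁅c, r⁆ = 0 := by
  have h4 : ⁅d, ⁅d, ⁅d, ⁅d, ⁅a, p⁆⁆⁆⁆⁆ = 0 := by simp [hw]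
  simp only [leibniz_lie d, lie_add, hb, hc, hd, hq, hr, hdr, zero_lie, lie_zero, zero_add,
    add_zero] at h4
  have : (6 : ℚ) • ⁅c, r⁆ = 0 := by
    rw [← h4]
    module
  simpa using this

theorem lie_lie_pow_three_eq_zero {x y z : L} (hzx : ⁅z, x⁆ = 0) (hy : ⁅y, ⁅y, ⁅y, x⁆⁆⁆ = 0)
    (hyz : ⁅y, ⁅y, z⁆⁆ = 0) (hzy : ⁅z, ⁅z, y⁆⁆ = 0) :
    ⁅⁅y, z⁆, ⁅⁅y, z⁆, ⁅⁅y, z⁆, x⁆⁆⁆ = 0 := by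
  obtain ⟨a, ha⟩ : ∃ a, a = ⁅y, z⁆ := ⟨_, rfl⟩
  have hya (m : L) : ⁅y, ⁅a, m⁆⁆ = ⁅a, ⁅y, m⁆⁆ := by
    rw [leibniz_lie, ha, hyz, zero_lie, zero_add]
  have hza (m : L) : ⁅z, ⁅a, m⁆⁆ = ⁅a, ⁅z, m⁆⁆ := by
    rw [leibniz_lie, ha, ← lie_skew y z, lie_neg, hzy, neg_zero, zero_lie, zero_add]
  have hyzm (m : L) : ⁅y, ⁅z, m⁆⁆ = ⁅a, m⁆ + ⁅z, ⁅y, m⁆⁆ := by rw [leibniz_lie, ha]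
  have h1 : ⁅z, ⁅y, x⁆⁆ = -⁅a, x⁆ := by
    have := hyzm x
    rw [hzx, lie_zero] at this
    exact (neg_eq_of_add_eq_zero_right this.symm).symm
  have h2 : ⁅z, ⁅y, ⁅y, x⁆⁆⁆ = (-2 : ℚ) • ⁅a, ⁅y, x⁆⁆ := by
    have h := hyzm ⁅y, x⁆
    simp only [h1, lie_neg, hya] at h
    linear_combination (norm := module) -h
  have h3 : ⁅a, ⁅y, ⁅y, x⁆⁆⁆ = 0 := by
    have h := hyzm ⁅y, ⁅y, x⁆⁆
    rw [h2, hy, lie_smul, hya, lie_zero] at h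
    have : (3 : ℚ) • ⁅a, ⁅y, ⁅y, x⁆⁆⁆ = 0 := by
      linear_combination (norm := module) -h
    simpa using this
  have h4 : ⁅a, ⁅a, ⁅y, x⁆⁆⁆ = 0 := by
    have h := congrArg (fun w => ⁅z, w⁆) h3
    simpa [hza, h2, -lie_skew] using h
  have h5 := congrArg (fun w => ⁅z, w⁆) h4
  rw [← ha]
  simpa only [hza, h1, lie_neg, lie_zero, neg_eq_zero] using h5

end Brackets

section Rank3

variable {L : Type*} [LieRing L] [LieAlgebra ℚ L]

/-- The root vector of root `2α₁ + α₂ + α₃` built from the family `e`. -/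
def rootVector (e : Fin 3 → L) : L := (1 / 2 : ℚ) • ⁅e 0, ⁅e 0, ⁅e 1, e 2⁆⁆⁆

/-- The coroot of `2α₁ + α₂ + α₃` built from the family `h`. -/
def coroot (h : Fin 3 → L) : L := (2 : ℚ) • h 0 + h 1 + h 2

theorem coroot_neg (h : Fin 3 → L) : coroot (-h) = -coroot h := by
  simp only [coroot, Pi.neg_apply]
  module

namespace IsSerreFamily

theorem symm {R B L : Type*} [CommRing R] [LieRing L] [LieAlgebra R L] {A : Matrix B B ℤ}
    {h e f : B → L} (hS : IsSerreFamily R A h e f) : IsSerreFamily R A (-h) f e where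
  lie_h_h i j := by simp [hS.lie_h_h]
  lie_e_f_self i := by rw [← lie_skew, hS.lie_e_f_self, Pi.neg_apply]
  lie_e_f_of_ne i j hij := by rw [← lie_skew, hS.lie_e_f_of_ne j i hij.symm, neg_zero]
  lie_h_e i j := by simp [hS.lie_h_f]
  lie_h_f i j := by simp [hS.lie_h_e]
  ad_e_pow := hS.ad_f_pow
  ad_f_pow := hS.ad_e_pow

variable {h e f : Fin 3 → L}

theorem serre_zero_one (hS : IsSerreFamily ℚ Amat h e f) : ⁅e 0, ⁅e 0, ⁅e 0, e 1⁆⁆⁆ = 0 := by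
  simpa [Amat, pow_succ'] using hS.ad_e_pow 0 1

theorem serre_one_zero (hS : IsSerreFamily ℚ Amat h e f) : ⁅e 1, ⁅e 1, ⁅e 1, e 0⁆⁆⁆ = 0 := by
  simpa [Amat, pow_succ'] using hS.ad_e_pow 1 0

theorem serre_zero_two (hS : IsSerreFamily ℚ Amat h e f) : ⁅e 0, e 2⁆ = 0 := by
  simpa [Amat] using hS.ad_e_pow 0 2

theorem serre_one_two (hS : IsSerreFamily ℚ Amat h e f) : ⁅e 1, ⁅e 1, e 2⁆⁆ = 0 := by
  simpa [Amat] using hS.ad_e_pow 1 2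

theorem serre_two_one (hS : IsSerreFamily ℚ Amat h e f) : ⁅e 2, ⁅e 2, e 1⁆⁆ = 0 := by
  simpa [Amat] using hS.ad_e_pow 2 1

theorem serre_two_zero (hS : IsSerreFamily ℚ Amat h e f) : ⁅e 2, e 0⁆ = 0 := by
  simpa [Amat] using hS.ad_e_pow 2 0

theorem lie_e_zero_pow_three (hS : IsSerreFamily ℚ Amat h e f) :
    ⁅e 0, ⁅e 0, ⁅e 0, ⁅e 1, e 2⁆⁆⁆⁆ = 0 := by
  have (m : L) : ⁅e 0, ⁅m, e 2⁆⁆ = ⁅⁅e 0, m⁆, e 2⁆ := by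
    rw [leibniz_lie, hS.serre_zero_two, lie_zero, add_zero]
  rw [this, this, this, hS.serre_zero_one, zero_lie]

theorem lie_rootVector_f_one (hS : IsSerreFamily ℚ Amat h e f) : ⁅rootVector e, f 1⁆ = 0 := by
  rw [← lie_skew, neg_eq_zero]
  have h10 : ⁅f 1, e 0⁆ = 0 := hS.symm.lie_e_f_of_ne 1 0 (by decide)
  have h12 : ⁅f 1, e 2⁆ = 0 := hS.symm.lie_e_f_of_ne 1 2 (by decide)
  have h11 : ⁅f 1, e 1⁆ = -h 1 := hS.symm.lie_e_f_self 1
  simp [rootVector, leibniz_lie (f 1), h10, h12, h11, hS.lie_h_e, hS.serre_zero_two]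

theorem lie_f_zero_lie_lie (hS : IsSerreFamily ℚ Amat h e f) {a : L}
    (ha : ⁅f 0, a⁆ = 0) (hha : ⁅h 0, a⁆ = -(2 • a)) :
    ⁅f 0, ⁅e 0, a⁆⁆ = (2 : ℚ) • a ∧ ⁅f 0, ⁅e 0, ⁅e 0, a⁆⁆⁆ = (2 : ℚ) • ⁅e 0, a⁆ := by
  have h00 : ⁅f 0, e 0⁆ = -h 0 := hS.symm.lie_e_f_self 0
  have h1 : ⁅f 0, ⁅e 0, a⁆⁆ = (2 : ℚ) • a := by
    rw [leibniz_lie, h00, ha, neg_lie, hha, lie_zero]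
    module
  refine ⟨h1, ?_⟩
  have h2 : ⁅h 0, ⁅e 0, a⁆⁆ = 0 := by
    rw [leibniz_lie, hS.lie_h_e, hha]
    simp [Amat]
    module
  rw [leibniz_lie, h1, h00, neg_lie, h2, lie_smul]
  simp

theorem lie_f_zero_e_one (hS : IsSerreFamily ℚ Amat h e f) :
    ⁅f 0, ⁅e 0, e 1⁆⁆ = (2 : ℚ) • e 1 ∧
      ⁅f 0, ⁅e 0, ⁅e 0, e 1⁆⁆⁆ = (2 : ℚ) • ⁅e 0, e 1⁆ :=
  hS.lie_f_zero_lie_lie (hS.symm.lie_e_f_of_ne 0 1 (by decide)) (by simp [hS.lie_h_e, Amat]; module)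

theorem lie_f_zero_lie_e_one_e_two (hS : IsSerreFamily ℚ Amat h e f) :
    ⁅f 0, ⁅e 0, ⁅e 1, e 2⁆⁆⁆ = (2 : ℚ) • ⁅e 1, e 2⁆ ∧
      ⁅f 0, ⁅e 0, ⁅e 0, ⁅e 1, e 2⁆⁆⁆⁆ = (2 : ℚ) • ⁅e 0, ⁅e 1, e 2⁆⁆ := by
  have h01 : ⁅f 0, e 1⁆ = 0 := hS.symm.lie_e_f_of_ne 0 1 (by decide)
  have h02 : ⁅f 0, e 2⁆ = 0 := hS.symm.lie_e_f_of_ne 0 2 (by decide)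
  refine hS.lie_f_zero_lie_lie ?_ ?_
  · rw [leibniz_lie, h01, h02, zero_lie, lie_zero, add_zero]
  · rw [leibniz_lie, hS.lie_h_e, hS.lie_h_e]
    simp [Amat]
    module

theorem lie_rootVector_rootVector (hS : IsSerreFamily ℚ Amat h e f) :
    ⁅rootVector e, -rootVector f⁆ = coroot h := by
  obtain ⟨z, hz⟩ : ∃ z, z = ⁅f 1, f 2⁆ := ⟨_, rfl⟩
  obtain ⟨y, hy⟩ : ∃ y, y = ⁅e 1, e 2⁆ := ⟨_, rfl⟩
  obtain ⟨hy1, hy2⟩ := hS.lie_f_zero_lie_e_one_e_two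
  rw [← hy] at hy1 hy2
  have h00 : ⁅f 0, e 0⁆ = -h 0 := hS.symm.lie_e_f_self 0
  have h11 := hS.lie_e_f_self 1
  have h22 := hS.lie_e_f_self 2
  have h01 := hS.lie_e_f_of_ne 0 1 (by decide)
  have h02 := hS.lie_e_f_of_ne 0 2 (by decide)
  have h12 := hS.lie_e_f_of_ne 1 2 (by decide)
  have h21 := hS.lie_e_f_of_ne 2 1 (by decide)
  have he0z : ⁅e 0, z⁆ = 0 := by rw [hz, leibniz_lie, h01, h02, zero_lie, lie_zero, add_zero]
  have he1z : ⁅e 1, z⁆ = f 2 := by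
    rw [hz, leibniz_lie, h11, h12, lie_zero, hS.lie_h_f]
    simp [Amat]
  have he2z : ⁅e 2, z⁆ = -f 1 := by
    rw [hz, leibniz_lie, h21, h22, ← lie_skew _ (h 2), hS.lie_h_f]
    simp [Amat]
  have hyz : ⁅y, z⁆ = -(h 1 + h 2) := by
    rw [hy, lie_lie, he1z, he2z, h22, lie_neg, h11]
    abel
  have hy1z : ⁅⁅e 0, y⁆, z⁆ = (-2 : ℚ) • e 0 := by
    rw [lie_lie, hyz, he0z, lie_zero, ← lie_skew, neg_lie, add_lie, hS.lie_h_e, hS.lie_h_e]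
    simp [Amat]
    module
  have hy2z : ⁅⁅e 0, ⁅e 0, y⁆⁆, z⁆ = 0 := by
    rw [lie_lie, hy1z, he0z, lie_zero, lie_smul, lie_self, smul_zero, sub_zero]
  have hy2z1 : ⁅⁅e 0, ⁅e 0, y⁆⁆, ⁅f 0, z⁆⁆ = (4 : ℚ) • e 0 := by
    rw [leibniz_lie, hy2z, lie_zero, ← lie_skew _ (f 0), hy2, neg_lie, smul_lie, hy1z]
    module
  have hy1z1 : ⁅⁅e 0, y⁆, ⁅f 0, z⁆⁆ = (2 : ℚ) • (h 1 + h 2) + (2 : ℚ) • h 0 := by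
    rw [leibniz_lie, hy1z, ← lie_skew _ (f 0), hy1, neg_lie, smul_lie, hyz, lie_smul, h00]
    module
  rw [rootVector, rootVector, coroot, ← hy, ← hz, lie_neg, smul_lie, lie_smul, leibniz_lie _ (f 0), hy2z1,
    ← lie_skew _ (f 0), hy2, neg_lie, smul_lie, hy1z1, lie_smul, h00]
  module

theorem lie_h_rootVector (hS : IsSerreFamily ℚ Amat h e f) (i : Fin 3) :
    ⁅h i, rootVector e⁆ = (2 * Amat i 0 + Amat i 1 + Amat i 2) • rootVector e := by
  simp only [rootVector, lie_smul, leibniz_lie (h i), hS.lie_h_e, smul_lie, lie_add]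
  module

theorem mem_engel_rootVector (hS : IsSerreFamily ℚ Amat h e f) :
    e 1 ∈ LieSubalgebra.engel ℚ (rootVector e) := by
  refine LieSubalgebra.engel_le_engel_smul _ _ ?_
  set c := ⁅e 0, ⁅e 0, ⁅e 1, e 2⁆⁆⁆ with hc
  have hw : ⁅⁅e 1, e 2⁆, e 1⁆ = 0 := by rw [← lie_skew, hS.serre_one_two, neg_zero]
  have hcu : ⁅c, ⁅e 0, ⁅e 0, e 1⁆⁆⁆ = 0 :=
    lie_top_top_eq_zero rfl rfl hS.lie_e_zero_pow_three rfl rfl hS.serre_zero_one hw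
  have hcc : ⁅c, ⁅c, ⁅e 0, ⁅e 1, e 2⁆⁆⁆⁆ = 0 :=
    lie_lie_top_eq_zero rfl rfl hS.lie_e_zero_pow_three
      (lie_lie_pow_three_eq_zero hS.serre_two_zero hS.serre_one_zero hS.serre_one_two
        hS.serre_two_one)
  have hcf : ⁅c, f 0⁆ = (-2 : ℚ) • ⁅e 0, ⁅e 1, e 2⁆⁆ := by
    rw [← lie_skew, hc, hS.lie_f_zero_lie_e_one_e_two.2]
    module
  have hu : ⁅e 0, ⁅e 0, e 1⁆⁆ ∈ LieSubalgebra.engel ℚ c :=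
    (LieSubalgebra.mem_engel_iff ..).2 ⟨1, by simpa using hcu⟩
  have hf : f 0 ∈ LieSubalgebra.engel ℚ c :=
    (LieSubalgebra.mem_engel_iff ..).2 ⟨3, by simp [pow_succ', hcf, hcc]⟩
  have h2 := LieSubalgebra.lie_mem _ hf (LieSubalgebra.lie_mem _ hf hu)
  rw [hS.lie_f_zero_e_one.2, lie_smul, hS.lie_f_zero_e_one.1, smul_smul] at h2
  convert SMulMemClass.smul_mem (1 / 4 : ℚ) h2 using 1
  module

theorem rootVector_mem_engel (hS : IsSerreFamily ℚ Amat h e f) :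
    rootVector e ∈ LieSubalgebra.engel ℚ (e 1) := by
  have h0 : e 0 ∈ LieSubalgebra.engel ℚ (e 1) :=
    (LieSubalgebra.mem_engel_iff ..).2 ⟨3, by simpa [pow_succ'] using hS.serre_one_zero⟩
  have h2 : e 2 ∈ LieSubalgebra.engel ℚ (e 1) :=
    (LieSubalgebra.mem_engel_iff ..).2 ⟨2, by simpa [pow_succ'] using hS.serre_one_two⟩
  exact SMulMemClass.smul_mem _ <| LieSubalgebra.lie_mem _ h0 <| LieSubalgebra.lie_mem _ h0 <|
    LieSubalgebra.lie_mem _ (LieSubalgebra.self_mem_engel ℚ (e 1)) h2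

theorem lie_coroot_e_one (hS : IsSerreFamily ℚ Amat h e f) :
    ⁅coroot h, e 1⁆ = (-3 : ℚ) • e 1 := by
  simp only [coroot, add_lie, smul_lie, hS.lie_h_e, Amat]
  simp
  module

theorem lie_coroot_rootVector (hS : IsSerreFamily ℚ Amat h e f) :
    ⁅coroot h, rootVector e⁆ = (2 : ℚ) • rootVector e := by
  simp only [coroot, add_lie, smul_lie, hS.lie_h_rootVector, Amat]
  simp
  module

theorem lie_h_one_rootVector (hS : IsSerreFamily ℚ Amat h e f) :
    ⁅h 1, rootVector e⁆ = (-3 : ℚ) • rootVector e := by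
  rw [hS.lie_h_rootVector]
  simp [Amat]
  module

theorem ad_e_one_pow (hS : IsSerreFamily ℚ Amat h e f) :
    (ad ℚ L (e 1) ^ 3) ⁅e 1, rootVector e⁆ = 0 := by
  have h1 : (ad ℚ L (e 1) ^ (3 + 1)) (rootVector e) = 0 :=
    ad_pow_succ_apply_eq_zero_of_mem_engel (hS.lie_e_f_self 1) (by simp [hS.lie_h_e, Amat]; module)
      (by simp [hS.lie_h_f, Amat]; module)
      (by rw [hS.lie_h_one_rootVector]; push_cast; module)
      (by rw [← lie_skew, hS.lie_rootVector_f_one, neg_zero]) hS.rootVector_mem_engel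
  simpa only [pow_succ, Module.End.mul_apply, ad_apply] using h1

theorem ad_rootVector_pow (hS : IsSerreFamily ℚ Amat h e f) :
    (ad ℚ L (rootVector e) ^ 3) ⁅rootVector e, e 1⁆ = 0 := by
  have hf := hS.symm.lie_coroot_rootVector
  rw [coroot_neg, neg_lie] at hf
  have h1 : (ad ℚ L (rootVector e) ^ (3 + 1)) (e 1) = 0 :=
    ad_pow_succ_apply_eq_zero_of_mem_engel hS.lie_rootVector_rootVector
      (by rw [hS.lie_coroot_rootVector]; module)
      (by rw [lie_neg, hf]; module)
      (by rw [hS.lie_coroot_e_one]; push_cast; module)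
      (by rw [neg_lie, hS.symm.lie_rootVector_f_one, neg_zero]) hS.mem_engel_rootVector
  simpa only [pow_succ, Module.End.mul_apply, ad_apply] using h1

/-- The root vectors of roots `±(2α₁ + α₂ + α₃)` and `±α₂` satisfy the Serre relations of `Bmat`. -/
theorem rankTwo (hS : IsSerreFamily ℚ Amat h e f) :
    IsSerreFamily ℚ Bmat ![coroot h, h 1] ![rootVector e, e 1] ![-rootVector f, f 1] where
  lie_h_h i j := by
    fin_cases i <;> fin_cases j <;> simp [coroot, hS.lie_h_h]
  lie_e_f_self i := by
    fin_cases i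
    · exact hS.lie_rootVector_rootVector
    · exact hS.lie_e_f_self 1
  lie_e_f_of_ne i j hij := by
    have := hS.symm.lie_rootVector_f_one
    fin_cases i <;> fin_cases j
    · exact absurd rfl hij
    · exact hS.lie_rootVector_f_one
    · change ⁅e 1, -rootVector f⁆ = 0
      rw [lie_neg, lie_skew, this]
    · exact absurd rfl hij
  lie_h_e i j := by
    fin_cases i <;> fin_cases j <;>
      simp [Bmat, hS.lie_coroot_rootVector, hS.lie_coroot_e_one, hS.lie_h_one_rootVector,
        hS.lie_h_e, Amat] <;> module
  lie_h_f i j := by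
    have h00 := neg_eq_iff_eq_neg.1 (neg_lie (coroot h) (rootVector f) ▸ coroot_neg h ▸
      hS.symm.lie_coroot_rootVector)
    have h01 := neg_eq_iff_eq_neg.1 (neg_lie (coroot h) (f 1) ▸ coroot_neg h ▸
      hS.symm.lie_coroot_e_one)
    have h10 := neg_eq_iff_eq_neg.1 (neg_lie (h 1) (rootVector f) ▸ hS.symm.lie_h_one_rootVector)
    fin_cases i <;> fin_cases j <;>
      simp [Bmat, h00, h01, h10, hS.lie_h_f, Amat] <;> module
  ad_e_pow i j := by
    fin_cases i <;> fin_cases j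
    · simp [Bmat]
    · exact hS.ad_rootVector_pow
    · exact hS.ad_e_one_pow
    · simp [Bmat]
  ad_f_pow i j := by
    fin_cases i <;> fin_cases j
    · simp [Bmat]
    · change (ad ℚ L (-rootVector f) ^ 3) ⁅-rootVector f, f 1⁆ = 0
      rw [map_neg, neg_lie, map_neg, Odd.neg_pow (by decide), LinearMap.neg_apply, neg_neg,
        hS.symm.ad_rootVector_pow]
    · change (ad ℚ L (f 1) ^ 3) ⁅f 1, -rootVector f⁆ = 0
      rw [lie_neg, map_neg, hS.symm.ad_e_one_pow, neg_zero]
    · simp [Bmat]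

end IsSerreFamily

end Rank3

/-- There is a Lie algebra homomorphism 𝓗 → 𝓕 carrying the Serre generators of 𝓗 to
E₁, E₂, F₁, F₂, H₁, H₂; i.e. these elements satisfy the Serre relations of B inside 𝓕. -/
theorem exists_lieHom_fib_to_F :
    ∃ φ : 𝓗 →ₗ⁅ℚ⁆ 𝓕,
      φ (e' 0) = E₁ ∧ φ (e' 1) = E₂ ∧
      φ (f' 0) = F₁ ∧ φ (f' 1) = F₂ ∧
      φ (h' 0) = H₁ ∧ φ (h' 1) = H₂ := by
  obtain ⟨φ, hh, he, hf⟩ :=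
    (Amat.isSerreFamily_toLieAlgebraMk (R := ℚ)).rankTwo.exists_lieHom
  exact ⟨φ, he 0, he 1, hf 0, hf 1, hh 0, hh 1⟩

end
end

section
/- In 𝓕 one has ⁅E₁, F₁⁆ = H₁; equivalently, ⁅⁅e₁,⁅e₁,⁅e₂,e₃⁆⁆⁆, ⁅f₁,⁅f₁,⁅f₂,f₃⁆⁆⁆⁆ = -4•(2h₁ + h₂ + h₃). -/
/-! Statement 1: In 𝓕, ⁅E₁, F₁⁆ = H₁; equivalently
⁅⁅e₁,⁅e₁,⁅e₂,e₃⁆⁆⁆, ⁅f₁,⁅f₁,⁅f₂,f₃⁆⁆⁆⁆ = -4•(2h₁ + h₂ + h₃). -/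

noncomputable section

open CartanMatrix

theorem mk_eq_zero_of_mem_toSet {x : FreeLieAlgebra ℚ (Generators (Fin 3))}
    (hx : x ∈ Relations.toSet ℚ Amat) :
    LieSubmodule.Quotient.mk (N := Relations.toIdeal ℚ Amat) x = 0 :=
  (LieSubmodule.Quotient.mk_eq_zero _).2 (LieSubmodule.subset_lieSpan hx)

theorem lie_h_e (i j : Fin 3) : ⁅h i, e j⁆ = Amat i j • e j := by
  have key := mk_eq_zero_of_mem_toSet
    (x := Relations.HE ℚ Amat (i, j)) (by simp [Relations.toSet])
  exact sub_eq_zero.1 key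

theorem lie_e_f_self (i : Fin 3) : ⁅e i, f i⁆ = h i := by
  have key := mk_eq_zero_of_mem_toSet
    (x := Relations.EF ℚ (i, i)) (by simp [Relations.toSet])
  simp only [Relations.EF, Function.uncurry_apply_pair, if_true] at key
  exact sub_eq_zero.1 key

theorem lie_e_f_of_ne {i j : Fin 3} (hij : i ≠ j) : ⁅e i, f j⁆ = 0 := by
  have key := mk_eq_zero_of_mem_toSet
    (x := Relations.EF ℚ (i, j)) (by simp [Relations.toSet])
  simp only [Relations.EF, Function.uncurry_apply_pair, if_neg hij] at key
  exact key

theorem lie_e_e_of_Amat_eq_zero {i j : Fin 3} (hij : Amat i j = 0) : ⁅e i, e j⁆ = 0 := by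
  have key := mk_eq_zero_of_mem_toSet
    (x := Relations.adE ℚ Amat (i, j)) (by simp [Relations.toSet])
  simp only [Relations.adE, Function.uncurry_apply_pair, hij] at key
  exact key

theorem lie_f_e_self (i : Fin 3) : ⁅f i, e i⁆ = -h i := by
  rw [← lie_skew, lie_e_f_self]

theorem lie_f_e_of_ne {i j : Fin 3} (hij : i ≠ j) : ⁅f i, e j⁆ = 0 := by
  rw [← lie_skew, lie_e_f_of_ne hij.symm, neg_zero]

theorem lie_e_h (i j : Fin 3) : ⁅e i, h j⁆ = -(Amat j i • e i) := by
  rw [← lie_skew, lie_h_e]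

theorem lie_multibracket :
    ⁅⁅e 0, ⁅e 0, ⁅e 1, e 2⁆⁆⁆, ⁅f 0, ⁅f 0, ⁅f 1, f 2⁆⁆⁆⁆
      = (-4 : ℚ) • ((2 : ℚ) • h 0 + h 1 + h 2) := by
  have f1u : ⁅f 1, ⁅e 1, e 2⁆⁆ = e 2 := by
    simp [leibniz_lie (f 1), lie_f_e_self, lie_f_e_of_ne, lie_h_e, Amat]
  have f2u : ⁅f 2, ⁅e 1, e 2⁆⁆ = -e 1 := by
    simp [leibniz_lie (f 2), lie_f_e_self, lie_f_e_of_ne, lie_e_h, Amat]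
  have h0u : ⁅h 0, ⁅e 1, e 2⁆⁆ = (-2 : ℤ) • ⁅e 1, e 2⁆ := by
    simp [leibniz_lie (h 0), lie_h_e, Amat]
  have h0w : ⁅h 0, ⁅e 0, ⁅e 1, e 2⁆⁆⁆ = 0 := by
    simp [leibniz_lie (h 0) (e 0), h0u, lie_h_e, Amat]
  have f0u : ⁅f 0, ⁅e 1, e 2⁆⁆ = 0 := by
    simp [leibniz_lie (f 0), lie_f_e_of_ne]
  have f0w : ⁅f 0, ⁅e 0, ⁅e 1, e 2⁆⁆⁆ = (2 : ℤ) • ⁅e 1, e 2⁆ := by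
    simp [leibniz_lie (f 0) (e 0), f0u, h0u, lie_f_e_self]
  have f0x : ⁅f 0, ⁅e 0, ⁅e 0, ⁅e 1, e 2⁆⁆⁆⁆ = (2 : ℤ) • ⁅e 0, ⁅e 1, e 2⁆⁆ := by
    simp [leibniz_lie (f 0) (e 0) ⁅e 0, _⁆, f0w, h0w, lie_f_e_self]
  have f1e0 (m : 𝓕) : ⁅f 1, ⁅e 0, m⁆⁆ = ⁅e 0, ⁅f 1, m⁆⁆ := by
    simp [leibniz_lie (f 1) (e 0), lie_f_e_of_ne]
  have f2e0 (m : 𝓕) : ⁅f 2, ⁅e 0, m⁆⁆ = ⁅e 0, ⁅f 2, m⁆⁆ := by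
    simp [leibniz_lie (f 2) (e 0), lie_f_e_of_ne]
  have e0e2 : ⁅e 0, e 2⁆ = 0 := lie_e_e_of_Amat_eq_zero (by simp [Amat])
  have f1e1e0 : ⁅f 1, ⁅e 1, e 0⁆⁆ = (2 : ℤ) • e 0 := by
    simp [leibniz_lie (f 1), lie_f_e_self, lie_f_e_of_ne, lie_h_e, Amat]
  have vu : ⁅⁅f 1, f 2⁆, ⁅e 1, e 2⁆⁆ = h 1 + h 2 := by
    simp [lie_lie, f1u, f2u, lie_f_e_self]
  have vw : ⁅⁅f 1, f 2⁆, ⁅e 0, ⁅e 1, e 2⁆⁆⁆ = (2 : ℤ) • e 0 := by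
    simp [lie_lie, f1e0, f2e0, f1u, f2u, e0e2, f1e1e0]
  have vx : ⁅⁅f 1, f 2⁆, ⁅e 0, ⁅e 0, ⁅e 1, e 2⁆⁆⁆⁆ = 0 := by
    simp [lie_lie, f1e0, f2e0, f1u, f2u, e0e2, f1e1e0]
  rw [← lie_skew]
  simp only [lie_lie (f 0), f0x, f0w, lie_zsmul, vu, vw, vx, lie_sub, lie_zero, lie_f_e_self]
  module

/-- ⁅E₁, F₁⁆ = H₁ in 𝓕; equivalently, the big multibracket identity
⁅⁅e₁,⁅e₁,⁅e₂,e₃⁆⁆⁆, ⁅f₁,⁅f₁,⁅f₂,f₃⁆⁆⁆⁆ = -4•(2h₁ + h₂ + h₃). -/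
theorem bracket_E₁_F₁_eq_H₁ :
    ⁅E₁, F₁⁆ = H₁ ∧
    ⁅⁅e 0, ⁅e 0, ⁅e 1, e 2⁆⁆⁆, ⁅f 0, ⁅f 0, ⁅f 1, f 2⁆⁆⁆⁆
      = (-4 : ℚ) • ((2 : ℚ) • h 0 + h 1 + h 2) := by
  refine ⟨?_, lie_multibracket⟩
  rw [E₁, F₁, H₁, lie_neg, smul_lie, lie_smul, lie_multibracket]
  module

end
end

section
/- For all integers b, c, m and β := [[b+c+m, b],[b, c]], one has r₁(β) = [[b+c+m, -2b-c-m],[-2b-c-m, 3b+2c+m]] and r₂(β) = [[2c-b+m, c-b],[c-b, c]]. In particular r₁ and r₂ preserve the determinant (hence ‖·‖²) and the Fib-level, so for every m ∈ ℤ the level set Δ_m is W_Fib-invariant: W_Fib(Δ_m) = Δ_m. -/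
/-! Statement 5: explicit formulas for r₁, r₂ on level-m lattice points; r₁, r₂ preserve
the determinant (hence ‖·‖²) and the Fib-level, and Δ_m is W_Fib-invariant. -/

noncomputable section

open Matrix

/-- The symmetric 2×2 real matrix [[a,b],[b,c]]. -/
def sm (a b c : ℝ) : Matrix (Fin 2) (Fin 2) ℝ := !![a, b; b, c]

/-- The simple root α₁ = [[0,1],[1,0]] of 𝓕. -/
def α₁ : Matrix (Fin 2) (Fin 2) ℝ := sm 0 1 0

/-- The simple root α₂ = [[-1,-1],[-1,0]] of 𝓕. -/
def α₂ : Matrix (Fin 2) (Fin 2) ℝ := sm (-1) (-1) 0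

/-- The simple root α₃ = [[1,0],[0,-1]] of 𝓕. -/
def α₃ : Matrix (Fin 2) (Fin 2) ℝ := sm 1 0 (-1)

/-- The simple root β₁ = 2α₁+α₂+α₃ = [[0,1],[1,-1]] of 𝓕ib. -/
def β₁ : Matrix (Fin 2) (Fin 2) ℝ := sm 0 1 (-1)

/-- The simple root β₂ = α₂ of 𝓕ib. -/
def β₂ : Matrix (Fin 2) (Fin 2) ℝ := α₂

/-- The bilinear pairing ([[a,b],[b,c]], [[a',b'],[b',c']]) = 2bb' - ac' - a'c. -/
def pair (x y : Matrix (Fin 2) (Fin 2) ℝ) : ℝ :=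
  2 * x 0 1 * y 0 1 - x 0 0 * y 1 1 - y 0 0 * x 1 1

/-- The squared length ‖[[a,b],[b,c]]‖² = 2(b² - ac) = -2·det. -/
def sqLen (x : Matrix (Fin 2) (Fin 2) ℝ) : ℝ := pair x x

/-- The root lattice Q: all ℤ-linear combinations of α₁, α₂, α₃
(equivalently, all symmetric 2×2 integer matrices). -/
def Q : Set (Matrix (Fin 2) (Fin 2) ℝ) :=
  {γ | ∃ x y z : ℤ, γ = (x : ℝ) • α₁ + (y : ℝ) • α₂ + (z : ℝ) • α₃}

/-- The Fib root lattice Q_Fib = ℤβ₁ + ℤβ₂. -/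
def QFib : Set (Matrix (Fin 2) (Fin 2) ℝ) :=
  {γ | ∃ p q : ℤ, γ = (p : ℝ) • β₁ + (q : ℝ) • β₂}

/-- The root system Φ = {γ ∈ Q : γ ≠ 0 and ‖γ‖² ≤ 2} of 𝓕. -/
def Φ : Set (Matrix (Fin 2) (Fin 2) ℝ) := {γ ∈ Q | γ ≠ 0 ∧ sqLen γ ≤ 2}

/-- The Fib-level of [[a,b],[b,c]] is a - b - c. -/
def lvl (x : Matrix (Fin 2) (Fin 2) ℝ) : ℝ := x 0 0 - x 0 1 - x 1 1

/-- The set Δ_m of Fib-level-m roots of 𝓕. -/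
def Δ (m : ℤ) : Set (Matrix (Fin 2) (Fin 2) ℝ) := {γ ∈ Φ | lvl γ = (m : ℝ)}

/-- The projection to the Fib-plane: π(β) = β + ((a-b-c)/5)·[[-2,1],[1,2]],
where [[-2,1],[1,2]] = α₁ - 2α₃. -/
def proj (x : Matrix (Fin 2) (Fin 2) ℝ) : Matrix (Fin 2) (Fin 2) ℝ :=
  x + (lvl x / 5) • sm (-2) 1 2

/-- The simple reflection r₁ : β ↦ MβMᵀ with M = [[-1,0],[1,1]]. -/
def r₁ : Matrix (Fin 2) (Fin 2) ℝ → Matrix (Fin 2) (Fin 2) ℝ :=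
  fun x => !![(-1 : ℝ), 0; 1, 1] * x * (!![(-1 : ℝ), 0; 1, 1])ᵀ

/-- The simple reflection r₂ : β ↦ NβNᵀ with N = [[-1,1],[0,1]]. -/
def r₂ : Matrix (Fin 2) (Fin 2) ℝ → Matrix (Fin 2) (Fin 2) ℝ :=
  fun x => !![(-1 : ℝ), 1; 0, 1] * x * (!![(-1 : ℝ), 1; 0, 1])ᵀ

/-- The Fib Weyl group W_Fib: the collection of self-maps of the space of symmetric 2×2
real matrices generated by r₁ and r₂ under composition (a group, since r₁ and r₂ are
involutions). -/
def WFib : Submonoid (Function.End (Matrix (Fin 2) (Fin 2) ℝ)) :=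
  Submonoid.closure {r₁, r₂}

theorem r₁_sm (a b c : ℝ) : r₁ (sm a b c) = sm a (-a - b) (a + 2 * b + c) := by
  ext i j
  fin_cases i <;> fin_cases j <;>
    simp [r₁, sm, Matrix.mul_apply, Fin.sum_univ_two] <;> ring

theorem r₂_sm (a b c : ℝ) : r₂ (sm a b c) = sm (a - 2 * b + c) (c - b) c := by
  ext i j
  fin_cases i <;> fin_cases j <;>
    simp [r₂, sm, Matrix.mul_apply, Fin.sum_univ_two] <;> ring

theorem sqLen_sm (a b c : ℝ) : sqLen (sm a b c) = 2 * (b ^ 2 - a * c) := by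
  simp [sqLen, pair, sm]
  ring

theorem lvl_sm (a b c : ℝ) : lvl (sm a b c) = a - b - c := by
  simp [lvl, sm]

theorem Matrix.IsSymm.exists_eq_sm {x : Matrix (Fin 2) (Fin 2) ℝ} (hx : x.IsSymm) :
    ∃ a b c : ℝ, x = sm a b c := by
  refine ⟨x 0 0, x 0 1, x 1 1, ?_⟩
  ext i j
  fin_cases i <;> fin_cases j <;> simp [sm, hx.apply 0 1]

theorem mem_Q_iff {γ : Matrix (Fin 2) (Fin 2) ℝ} :
    γ ∈ Q ↔ ∃ a b c : ℤ, γ = sm a b c := by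
  have combination (x y z : ℝ) :
      x • α₁ + y • α₂ + z • α₃ = sm (z - y) (x - y) (-z) := by
    ext i j
    fin_cases i <;> fin_cases j <;> simp [α₁, α₂, α₃, sm] <;> ring
  constructor
  · rintro ⟨x, y, z, rfl⟩
    exact ⟨z - y, x - y, -z, by rw [combination]; push_cast; rfl⟩
  · rintro ⟨a, b, c, rfl⟩
    refine ⟨b - c - a, -c - a, -c, ?_⟩
    rw [combination]
    push_cast
    congr 1 <;> ring

theorem isSymm_of_mem_Q {γ : Matrix (Fin 2) (Fin 2) ℝ} (hγ : γ ∈ Q) : γ.IsSymm := by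
  obtain ⟨a, b, c, rfl⟩ := mem_Q_iff.1 hγ
  ext i j
  fin_cases i <;> fin_cases j <;> simp [sm]

theorem r₁_mem_Q {γ : Matrix (Fin 2) (Fin 2) ℝ} (hγ : γ ∈ Q) : r₁ γ ∈ Q := by
  obtain ⟨a, b, c, rfl⟩ := mem_Q_iff.1 hγ
  exact mem_Q_iff.2 ⟨a, -a - b, a + 2 * b + c, by rw [r₁_sm]; push_cast; rfl⟩

theorem r₂_mem_Q {γ : Matrix (Fin 2) (Fin 2) ℝ} (hγ : γ ∈ Q) : r₂ γ ∈ Q := by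
  obtain ⟨a, b, c, rfl⟩ := mem_Q_iff.1 hγ
  exact mem_Q_iff.2 ⟨a - 2 * b + c, c - b, c, by rw [r₂_sm]; push_cast; rfl⟩

theorem r₁_involutive_on_symm {x : Matrix (Fin 2) (Fin 2) ℝ} (hx : x.IsSymm) :
    r₁ (r₁ x) = x := by
  obtain ⟨a, b, c, rfl⟩ := hx.exists_eq_sm
  rw [r₁_sm, r₁_sm]
  congr 1 <;> ring

theorem r₂_involutive_on_symm {x : Matrix (Fin 2) (Fin 2) ℝ} (hx : x.IsSymm) :
    r₂ (r₂ x) = x := by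
  obtain ⟨a, b, c, rfl⟩ := hx.exists_eq_sm
  rw [r₂_sm, r₂_sm]
  congr 1 <;> ring

theorem sqLen_r₁ {x : Matrix (Fin 2) (Fin 2) ℝ} (hx : x.IsSymm) : sqLen (r₁ x) = sqLen x := by
  obtain ⟨a, b, c, rfl⟩ := hx.exists_eq_sm
  rw [r₁_sm, sqLen_sm, sqLen_sm]
  ring

theorem sqLen_r₂ {x : Matrix (Fin 2) (Fin 2) ℝ} (hx : x.IsSymm) : sqLen (r₂ x) = sqLen x := by
  obtain ⟨a, b, c, rfl⟩ := hx.exists_eq_sm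
  rw [r₂_sm, sqLen_sm, sqLen_sm]
  ring

theorem lvl_r₁ {x : Matrix (Fin 2) (Fin 2) ℝ} (hx : x.IsSymm) : lvl (r₁ x) = lvl x := by
  obtain ⟨a, b, c, rfl⟩ := hx.exists_eq_sm
  rw [r₁_sm, lvl_sm, lvl_sm]
  ring

theorem lvl_r₂ {x : Matrix (Fin 2) (Fin 2) ℝ} (hx : x.IsSymm) : lvl (r₂ x) = lvl x := by
  obtain ⟨a, b, c, rfl⟩ := hx.exists_eq_sm
  rw [r₂_sm, lvl_sm, lvl_sm]
  ring

/-- An involution of the lattice `Q` that fixes `0` and preserves length and level maps each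
level set onto itself. -/
theorem image_Δ_eq {f : Matrix (Fin 2) (Fin 2) ℝ → Matrix (Fin 2) (Fin 2) ℝ}
    (hzero : f 0 = 0) (hQ : ∀ γ ∈ Q, f γ ∈ Q) (hinv : ∀ γ ∈ Q, f (f γ) = γ)
    (hlen : ∀ γ ∈ Q, sqLen (f γ) = sqLen γ) (hlvl : ∀ γ ∈ Q, lvl (f γ) = lvl γ) (m : ℤ) :
    f '' Δ m = Δ m := by
  have hmaps : ∀ γ ∈ Δ m, f γ ∈ Δ m := by
    rintro γ ⟨⟨hγ, hne, hle⟩, hm⟩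
    refine ⟨⟨hQ γ hγ, fun h => hne ?_, (hlen γ hγ).trans_le hle⟩, (hlvl γ hγ).trans hm⟩
    rw [← hinv γ hγ, h, hzero]
  refine Set.Subset.antisymm (Set.image_subset_iff.2 hmaps) fun γ hγ => ?_
  exact ⟨f γ, hmaps γ hγ, hinv γ hγ.1.1⟩

theorem r₁_image_Δ (m : ℤ) : r₁ '' Δ m = Δ m :=
  image_Δ_eq (by simp [r₁]) (fun _ => r₁_mem_Q)
    (fun _ h => r₁_involutive_on_symm (isSymm_of_mem_Q h))
    (fun _ h => sqLen_r₁ (isSymm_of_mem_Q h)) (fun _ h => lvl_r₁ (isSymm_of_mem_Q h)) m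

theorem r₂_image_Δ (m : ℤ) : r₂ '' Δ m = Δ m :=
  image_Δ_eq (by simp [r₂]) (fun _ => r₂_mem_Q)
    (fun _ h => r₂_involutive_on_symm (isSymm_of_mem_Q h))
    (fun _ h => sqLen_r₂ (isSymm_of_mem_Q h)) (fun _ h => lvl_r₂ (isSymm_of_mem_Q h)) m

/-- Explicit formulas for r₁, r₂ on β = [[b+c+m,b],[b,c]]; preservation of determinant,
squared length and Fib-level; and W_Fib-invariance of each level set Δ_m. -/
theorem r_formulas_det_level_and_Wfib_invariance :
    (∀ b c m : ℤ,
      r₁ (sm (b + c + m) b c)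
          = sm (b + c + m) (-2*b - c - m) (3*b + 2*c + m) ∧
      r₂ (sm (b + c + m) b c) = sm (2*c - b + m) (c - b) c) ∧
    (∀ x : Matrix (Fin 2) (Fin 2) ℝ, (r₁ x).det = x.det ∧ (r₂ x).det = x.det) ∧
    (∀ x : Matrix (Fin 2) (Fin 2) ℝ, x.IsSymm →
      sqLen (r₁ x) = sqLen x ∧ sqLen (r₂ x) = sqLen x ∧
      lvl (r₁ x) = lvl x ∧ lvl (r₂ x) = lvl x) ∧
    (∀ m : ℤ, ∀ w ∈ WFib, w '' Δ m = Δ m) := by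
  refine ⟨fun b c m => ⟨?_, ?_⟩, fun x => ⟨?_, ?_⟩, fun x hx =>
    ⟨sqLen_r₁ hx, sqLen_r₂ hx, lvl_r₁ hx, lvl_r₂ hx⟩, fun m w hw => ?_⟩
  · rw [r₁_sm]
    congr 1 <;> ring
  · rw [r₂_sm]
    congr 1
    ring
  · simp only [r₁, Matrix.det_mul, Matrix.det_transpose, Matrix.det_fin_two_of]
    ring
  · simp only [r₂, Matrix.det_mul, Matrix.det_transpose, Matrix.det_fin_two_of]
    ring
  · induction hw using Submonoid.closure_induction with
    | mem w hw =>
      rcases hw with rfl | rfl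
      · exact r₁_image_Δ m
      · exact r₂_image_Δ m
    | one => exact Set.image_id _
    | mul v w _ _ hv hw =>
      exact (Set.image_comp v w (Δ m)).trans ((congrArg (v '' ·) hw).trans hv)

end
end

section
/- Define ψ([[a,b],[b,c]]) := [[-c,b],[b,-a]]. Then: (i) for every m ∈ ℤ with |m| ∉ {1,2}, ψ(Δ_m ∩ Φ₊) = Δ_m ∩ Φ₋; (ii) ψ(Δ₁ ∩ Φ₊ \ {α₁}) = Δ₁ ∩ Φ₋ \ {-α₁}; (iii) ψ(Δ₂ ∩ Φ₊ \ {α₃}) = Δ₂ ∩ Φ₋ \ {-α₃}. -/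
/-! Statement 7: ψ swaps positive and negative roots within each Fib-level, with the
exceptions of the fixed points ±α₁ on levels ±1 and ±α₃ on levels ±2. -/

noncomputable section

open Matrix

/-- ψ([[a,b],[b,c]]) := [[-c,b],[b,-a]]. -/
def ψ (x : Matrix (Fin 2) (Fin 2) ℝ) : Matrix (Fin 2) (Fin 2) ℝ :=
  !![-(x 1 1), x 0 1; x 1 0, -(x 0 0)]

/-- The positive roots Φ₊ = {xα₁+yα₂+zα₃ ∈ Φ : x, y, z ≥ 0}. -/
def Φpos : Set (Matrix (Fin 2) (Fin 2) ℝ) :=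
  {γ ∈ Φ | ∃ x y z : ℝ, 0 ≤ x ∧ 0 ≤ y ∧ 0 ≤ z ∧ γ = x • α₁ + y • α₂ + z • α₃}

/-- The negative roots Φ₋ = -Φ₊. -/
def Φneg : Set (Matrix (Fin 2) (Fin 2) ℝ) := {γ | -γ ∈ Φpos}

theorem sm_add_combination (x y z : ℝ) :
    x • α₁ + y • α₂ + z • α₃ = sm (z - y) (x - y) (-z) := by
  ext i j
  fin_cases i <;> fin_cases j <;> simp [α₁, α₂, α₃, sm] <;> ring

theorem sm_inj {a b c a' b' c' : ℝ} :
    sm a b c = sm a' b' c' ↔ a = a' ∧ b = b' ∧ c = c' := by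
  refine ⟨fun h => ⟨?_, ?_, ?_⟩, fun ⟨ha, hb, hc⟩ => by rw [ha, hb, hc]⟩
  · simpa [sm] using congrFun₂ h 0 0
  · simpa [sm] using congrFun₂ h 0 1
  · simpa [sm] using congrFun₂ h 1 1

theorem neg_sm (a b c : ℝ) : -sm a b c = sm (-a) (-b) (-c) := by
  ext i j
  fin_cases i <;> fin_cases j <;> simp [sm]

theorem zero_eq_sm : (0 : Matrix (Fin 2) (Fin 2) ℝ) = sm 0 0 0 := by
  ext i j
  fin_cases i <;> fin_cases j <;> simp [sm]

theorem ψ_sm (a b c : ℝ) : ψ (sm a b c) = sm (-c) b (-a) := by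
  simp [ψ, sm]

theorem ψ_ψ (γ : Matrix (Fin 2) (Fin 2) ℝ) : ψ (ψ γ) = γ := by
  ext i j
  fin_cases i <;> fin_cases j <;> simp [ψ]

theorem ψ_neg (γ : Matrix (Fin 2) (Fin 2) ℝ) : ψ (-γ) = -ψ γ := by
  ext i j
  fin_cases i <;> fin_cases j <;> simp [ψ]

theorem lvl_ψ (γ : Matrix (Fin 2) (Fin 2) ℝ) : lvl (ψ γ) = lvl γ := by
  simp [lvl, ψ]
  ring

theorem sqLen_ψ (γ : Matrix (Fin 2) (Fin 2) ℝ) : sqLen (ψ γ) = sqLen γ := by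
  simp [sqLen, pair, ψ]
  ring

theorem ψ_mem_Φ {γ : Matrix (Fin 2) (Fin 2) ℝ} (h : γ ∈ Φ) : ψ γ ∈ Φ := by
  obtain ⟨hQ, h0, hn⟩ := h
  refine ⟨?_, fun h => h0 ?_, (sqLen_ψ γ).trans_le hn⟩
  · obtain ⟨a, b, c, rfl⟩ := mem_Q_iff.1 hQ
    exact mem_Q_iff.2 ⟨-c, b, -a, by rw [ψ_sm]; push_cast; rfl⟩
  · rw [← ψ_ψ γ, h, zero_eq_sm, ψ_sm, neg_zero]

theorem ψ_mem_Δ {m : ℤ} {γ : Matrix (Fin 2) (Fin 2) ℝ} (h : γ ∈ Δ m) : ψ γ ∈ Δ m :=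
  ⟨ψ_mem_Φ h.1, (lvl_ψ γ).trans h.2⟩

theorem neg_mem_Φ {γ : Matrix (Fin 2) (Fin 2) ℝ} (h : γ ∈ Φ) : -γ ∈ Φ := by
  obtain ⟨hQ, h0, hn⟩ := h
  refine ⟨?_, neg_ne_zero.2 h0, by simpa [sqLen, pair] using hn⟩
  obtain ⟨a, b, c, rfl⟩ := mem_Q_iff.1 hQ
  exact mem_Q_iff.2 ⟨-a, -b, -c, by rw [neg_sm]; push_cast; rfl⟩

theorem sm_mem_Φpos_iff {a b c : ℝ} :
    sm a b c ∈ Φpos ↔ sm a b c ∈ Φ ∧ c ≤ 0 ∧ a + c ≤ 0 ∧ a + c ≤ b := by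
  refine and_congr_right fun _ => ⟨?_, fun ⟨h₁, h₂, h₃⟩ => ?_⟩
  · rintro ⟨x, y, z, hx, hy, hz, h⟩
    rw [sm_add_combination, sm_inj] at h
    obtain ⟨rfl, rfl, rfl⟩ := h
    refine ⟨?_, ?_, ?_⟩ <;> linarith
  · refine ⟨b - a - c, -a - c, -c, by linarith, by linarith, by linarith, ?_⟩
    rw [sm_add_combination, sm_inj]
    refine ⟨?_, ?_, ?_⟩ <;> ring

/-- A positive root `[[a,b],[b,c]]` other than `α₁` and `α₃` satisfies the inequalities that make
`[[c,-b],[-b,a]]` positive. -/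
theorem nonpos_and_add_le_neg {a b c : ℤ} (hn : b ^ 2 - a * c ≤ 1) (hc : c ≤ 0)
    (hac : a + c ≤ 0) (hb : a + c ≤ b) (h₁ : ¬(a = 0 ∧ b = 1 ∧ c = 0))
    (h₃ : ¬(a = 1 ∧ b = 0 ∧ c = -1)) : a ≤ 0 ∧ a + c ≤ -b := by
  have ha : a ≤ 0 := by
    by_contra! ha
    have hc' : c ≤ -1 := by omega
    have hb0 : b = 0 := by
      have : b ^ 2 ≤ 0 := by nlinarith
      exact pow_eq_zero_iff two_ne_zero |>.1 (le_antisymm this (sq_nonneg b))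
    have ha1 : a ≤ 1 := by nlinarith
    have hc1 : -1 ≤ c := by nlinarith
    exact h₃ ⟨by omega, hb0, by omega⟩
  refine ⟨ha, ?_⟩
  by_contra! h
  have hb' : 1 - (a + c) ≤ b := by omega
  have hsq : (1 - (a + c)) ^ 2 ≤ b ^ 2 := pow_le_pow_left₀ (by omega) hb' 2
  have hprod : 0 ≤ a * c := mul_nonneg_of_nonpos_of_nonpos ha hc
  have hsum : 0 ≤ a + c := by nlinarith [sq_nonneg a, sq_nonneg c]
  obtain rfl : a = 0 := by omega
  obtain rfl : c = 0 := by omega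
  exact h₁ ⟨rfl, by nlinarith, rfl⟩

theorem ψ_mem_Φneg {γ : Matrix (Fin 2) (Fin 2) ℝ} (h : γ ∈ Φpos) (h₁ : γ ≠ α₁) (h₃ : γ ≠ α₃) :
    ψ γ ∈ Φneg := by
  have hΦ : γ ∈ Φ := h.1
  obtain ⟨a, b, c, rfl⟩ := mem_Q_iff.1 hΦ.1
  obtain ⟨-, hc, hac, hb⟩ := sm_mem_Φpos_iff.1 h
  have hψ := neg_mem_Φ (ψ_mem_Φ hΦ)
  have hn : (b : ℝ) ^ 2 - a * c ≤ 1 := by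
    have := hΦ.2.2
    simp [sqLen, pair, sm] at this
    linarith
  rw [Ne, α₁, sm_inj] at h₁
  rw [Ne, α₃, sm_inj] at h₃
  obtain ⟨ha, hb'⟩ := nonpos_and_add_le_neg (a := a) (b := b) (c := c) (by exact_mod_cast hn)
    (by exact_mod_cast hc) (by exact_mod_cast hac) (by exact_mod_cast hb)
    (by exact_mod_cast h₁) (by exact_mod_cast h₃)
  have ha : (a : ℝ) ≤ 0 := by exact_mod_cast ha
  have hb' : (a : ℝ) + c ≤ -b := by exact_mod_cast hb'
  rw [ψ_sm, neg_sm] at hψ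
  rw [ψ_sm, Φneg, Set.mem_ofPred_eq, neg_sm, sm_mem_Φpos_iff]
  exact ⟨hψ, by linarith, by linarith, by linarith⟩

theorem ψ_mem_Φpos {γ : Matrix (Fin 2) (Fin 2) ℝ} (h : γ ∈ Φneg) (h₁ : γ ≠ -α₁)
    (h₃ : γ ≠ -α₃) : ψ γ ∈ Φpos := by
  have := ψ_mem_Φneg h (fun e => h₁ (neg_eq_iff_eq_neg.1 e)) (fun e => h₃ (neg_eq_iff_eq_neg.1 e))
  simpa [Φneg, ψ_neg] using this

theorem ψ_α₁ : ψ α₁ = α₁ := by simp [α₁, ψ_sm]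

theorem ψ_α₃ : ψ α₃ = α₃ := by simp [α₃, ψ_sm]

theorem neg_α₁_notMem_Φpos : -α₁ ∉ Φpos := by
  rw [α₁, neg_sm, sm_mem_Φpos_iff]
  norm_num

theorem neg_α₃_notMem_Φpos : -α₃ ∉ Φpos := by
  rw [α₃, neg_sm, sm_mem_Φpos_iff]
  norm_num

theorem image_ψ_diff (m : ℤ) :
    ψ '' ((Δ m ∩ Φpos) \ {α₁, α₃}) = (Δ m ∩ Φneg) \ {-α₁, -α₃} := by
  ext γ
  simp only [Set.mem_image, Set.mem_sdiff, Set.mem_inter_iff, Set.mem_insert_iff,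
    Set.mem_singleton_iff, not_or]
  constructor
  · rintro ⟨δ, ⟨⟨hΔ, hpos⟩, h₁, h₃⟩, rfl⟩
    refine ⟨⟨ψ_mem_Δ hΔ, ψ_mem_Φneg hpos h₁ h₃⟩, fun e => ?_, fun e => ?_⟩
    · apply neg_α₁_notMem_Φpos
      rwa [← ψ_α₁, ← ψ_neg, ← e, ψ_ψ]
    · apply neg_α₃_notMem_Φpos
      rwa [← ψ_α₃, ← ψ_neg, ← e, ψ_ψ]
  · rintro ⟨⟨hΔ, hneg⟩, h₁, h₃⟩
    refine ⟨ψ γ, ⟨⟨ψ_mem_Δ hΔ, ψ_mem_Φpos hneg h₁ h₃⟩, fun e => ?_, fun e => ?_⟩, ψ_ψ γ⟩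
    · apply neg_α₁_notMem_Φpos
      rwa [← ψ_α₁, ← e, ψ_ψ]
    · apply neg_α₃_notMem_Φpos
      rwa [← ψ_α₃, ← e, ψ_ψ]

theorem eq_neg_one_of_α₁_mem_Δ {m : ℤ} (h : α₁ ∈ Δ m) : m = -1 := by
  have : (m : ℝ) = -1 := by rw [← h.2]; simp [lvl, α₁, sm]
  exact_mod_cast this

theorem eq_one_of_neg_α₁_mem_Δ {m : ℤ} (h : -α₁ ∈ Δ m) : m = 1 := by
  have : (m : ℝ) = 1 := by rw [← h.2]; simp [lvl, α₁, sm]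
  exact_mod_cast this

theorem eq_two_of_α₃_mem_Δ {m : ℤ} (h : α₃ ∈ Δ m) : m = 2 := by
  have : (m : ℝ) = 2 := by rw [← h.2]; simp [lvl, α₃, sm]; norm_num
  exact_mod_cast this

theorem eq_neg_two_of_neg_α₃_mem_Δ {m : ℤ} (h : -α₃ ∈ Δ m) : m = -2 := by
  have : (m : ℝ) = -2 := by rw [← h.2]; simp [lvl, α₃, sm]; norm_num
  exact_mod_cast this

/-- (i) for |m| ∉ {1,2}, ψ(Δ_m ∩ Φ₊) = Δ_m ∩ Φ₋; (ii) ψ(Δ₁ ∩ Φ₊ \ {α₁}) = Δ₁ ∩ Φ₋ \ {-α₁};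
(iii) ψ(Δ₂ ∩ Φ₊ \ {α₃}) = Δ₂ ∩ Φ₋ \ {-α₃}. -/
theorem psi_swaps_positive_and_negative_roots :
    (∀ m : ℤ, |m| ≠ 1 → |m| ≠ 2 → ψ '' (Δ m ∩ Φpos) = Δ m ∩ Φneg) ∧
    ψ '' ((Δ 1 ∩ Φpos) \ {α₁}) = (Δ 1 ∩ Φneg) \ {-α₁} ∧
    ψ '' ((Δ 2 ∩ Φpos) \ {α₃}) = (Δ 2 ∩ Φneg) \ {-α₃} := by
  refine ⟨fun m hm₁ hm₂ => ?_, ?_, ?_⟩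
  · have h := image_ψ_diff m
    rwa [sdiff_eq_left.2, sdiff_eq_left.2] at h <;>
      rw [Set.disjoint_right] <;> rintro _ (rfl | rfl) ⟨hΔ, -⟩
    · exact hm₁ (by simp [eq_one_of_neg_α₁_mem_Δ hΔ])
    · exact hm₂ (by simp [eq_neg_two_of_neg_α₃_mem_Δ hΔ])
    · exact hm₁ (by simp [eq_neg_one_of_α₁_mem_Δ hΔ])
    · exact hm₂ (by simp [eq_two_of_α₃_mem_Δ hΔ])
  · have h := image_ψ_diff 1
    have h₃ : α₃ ∉ Δ 1 ∩ Φpos := fun h => absurd (eq_two_of_α₃_mem_Δ h.1) (by norm_num)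
    have h₃' : -α₃ ∉ Δ 1 ∩ Φneg := fun h =>
      absurd (eq_neg_two_of_neg_α₃_mem_Δ h.1) (by norm_num)
    rwa [Set.pair_comm, Set.pair_comm (-α₁), Set.sdiff_insert_of_notMem h₃,
      Set.sdiff_insert_of_notMem h₃'] at h
  · have h := image_ψ_diff 2
    have h₁ : α₁ ∉ Δ 2 ∩ Φpos := fun h => absurd (eq_neg_one_of_α₁_mem_Δ h.1) (by norm_num)
    have h₁' : -α₁ ∉ Δ 2 ∩ Φneg := fun h =>
      absurd (eq_one_of_neg_α₁_mem_Δ h.1) (by norm_num)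
    rwa [Set.sdiff_insert_of_notMem h₁, Set.sdiff_insert_of_notMem h₁'] at h

end
end

section
/- If γ ∈ Q satisfies (β₁,γ) = 0 and (β₂,γ) = 0, then γ = t·(α₁ - 2α₃) for some t ∈ ℤ; moreover ‖t(α₁-2α₃)‖² = 10t², so the only such γ lying in Φ ∪ {0} is γ = 0. (This is the lattice content of: the only trivial 𝓕ib-submodules of 𝓕 lie in the Cartan subalgebra.) -/
/-! Statement 8: lattice points orthogonal to the Fib-plane are the integer multiples of
α₁ - 2α₃, which have squared length 10t²; the only one in Φ ∪ {0} is 0. -/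

noncomputable section

open Matrix

/-- The squared length of a multiple of `α₁ - 2α₃`. -/
lemma sqLen_smul_normal (t : ℝ) : sqLen (t • (α₁ - (2 : ℝ) • α₃)) = 10 * t ^ 2 := by
  simp [sqLen, pair, α₁, α₃, sm]
  ring

/-- A lattice point orthogonal to `β₁` and `β₂` is an integer multiple of `α₁ - 2α₃`. -/
lemma exists_eq_smul_of_orthogonal {γ : Matrix (Fin 2) (Fin 2) ℝ} (hγ : γ ∈ Q)
    (h1 : pair β₁ γ = 0) (h2 : pair β₂ γ = 0) :
    ∃ t : ℤ, γ = (t : ℝ) • (α₁ - (2 : ℝ) • α₃) := by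
  obtain ⟨x, y, z, rfl⟩ := hγ
  simp [pair, β₁, β₂, α₁, α₂, α₃, sm] at h1 h2
  have hy : (y : ℝ) = 0 := by linarith
  have hz : (z : ℝ) = -2 * x := by linarith
  refine ⟨x, ?_⟩
  rw [hy, hz]
  module

/-- If γ ∈ Q is orthogonal to β₁ and β₂ then γ = t(α₁ - 2α₃) for some t ∈ ℤ; moreover
‖t(α₁-2α₃)‖² = 10t², so the only such γ in Φ ∪ {0} is γ = 0. -/
theorem orthogonal_to_fib_plane (γ : Matrix (Fin 2) (Fin 2) ℝ) (hγ : γ ∈ Q)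
    (h1 : pair β₁ γ = 0) (h2 : pair β₂ γ = 0) :
    (∃ t : ℤ, γ = (t : ℝ) • (α₁ - (2 : ℝ) • α₃)) ∧
    (∀ t : ℤ, sqLen ((t : ℝ) • (α₁ - (2 : ℝ) • α₃)) = 10 * (t : ℝ) ^ 2) ∧
    (γ ∈ Φ ∪ {0} → γ = 0) := by
  obtain ⟨t, rfl⟩ := exists_eq_smul_of_orthogonal hγ h1 h2
  refine ⟨⟨t, rfl⟩, fun s => sqLen_smul_normal s, ?_⟩
  rintro (⟨-, -, hlen⟩ | h0)
  · rw [sqLen_smul_normal] at hlen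
    have ht : t ^ 2 < 1 := by
      have : (t : ℝ) ^ 2 < 1 := by linarith
      exact_mod_cast this
    have ht0 : t = 0 := by
      rwa [sq_lt_one_iff_abs_lt_one, Int.abs_lt_one_iff] at ht
    simp [ht0]
  · exact h0

end
end

section
/- Let β = [[a,b],[b,c]] ∈ Φ and set m := a-b-c (the Fib-level of β). Then: (a) if |m| > 2, ‖π(β)‖² < 0; (b) if |m| ≤ 2, ‖π(β)‖² > 0 if and only if ‖β‖² = 2 (i.e. β is a real root). -/
/-! Statement 10: sign of ‖π(β)‖² for roots β ∈ Φ, according to the Fib-level m. -/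

noncomputable section

open Matrix

/-- Projecting away the Fib-level `m` lowers the squared length by `2m²/5`. -/
theorem sqLen_proj (x : Matrix (Fin 2) (Fin 2) ℝ) :
    sqLen (proj x) = sqLen x - 2 / 5 * lvl x ^ 2 := by
  simp [sqLen, proj, pair, lvl, sm]
  ring

/-- Elements of the root lattice have even squared length. -/
theorem exists_sqLen_eq_two_mul {x : Matrix (Fin 2) (Fin 2) ℝ} (hx : x ∈ Q) :
    ∃ n : ℤ, sqLen x = 2 * n := by
  obtain ⟨x, y, z, rfl⟩ := hx
  refine ⟨(x - y) ^ 2 + (z - y) * z, ?_⟩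
  simp [sqLen, pair, sm, α₁, α₂, α₃]
  ring

/-- The Fib-level is integral on the root lattice. -/
theorem exists_lvl_eq_intCast {x : Matrix (Fin 2) (Fin 2) ℝ} (hx : x ∈ Q) :
    ∃ n : ℤ, lvl x = n := by
  obtain ⟨x, y, z, rfl⟩ := hx
  refine ⟨2 * z - x, ?_⟩
  simp [lvl, sm, α₁, α₂, α₃]
  ring

/-- For β ∈ Φ with m its Fib-level: (a) if |m| > 2 then ‖π(β)‖² < 0;
(b) if |m| ≤ 2 then ‖π(β)‖² > 0 iff ‖β‖² = 2 (i.e. β is a real root). -/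
theorem proj_sqLen_sign (β : Matrix (Fin 2) (Fin 2) ℝ) (hβ : β ∈ Φ) :
    (2 < |lvl β| → sqLen (proj β) < 0) ∧
    (|lvl β| ≤ 2 → (0 < sqLen (proj β) ↔ sqLen β = 2)) := by
  obtain ⟨hQ, -, hle⟩ := hβ
  obtain ⟨n, hn⟩ := exists_sqLen_eq_two_mul hQ
  obtain ⟨m, hm⟩ := exists_lvl_eq_intCast hQ
  rw [sqLen_proj]
  refine ⟨fun h => ?_, fun h => ⟨fun hpos => ?_, fun heq => ?_⟩⟩
  · rw [hm] at h ⊢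
    have h3 : (3 : ℤ) ≤ |m| := by exact_mod_cast h
    have h3' : (3 : ℝ) ≤ |(m : ℝ)| := by exact_mod_cast h3
    nlinarith [sq_abs (m : ℝ)]
  · have hpos' : (0 : ℝ) < n := by nlinarith [sq_nonneg (lvl β)]
    have hn1 : (1 : ℤ) ≤ n := by exact_mod_cast hpos'
    have hn1' : (1 : ℝ) ≤ n := by exact_mod_cast hn1
    linarith
  · nlinarith [sq_abs (lvl β), abs_nonneg (lvl β)]

end
end

section
/- For all integers b, c, m, let β := [[b+c+m, b],[b, c]] ∈ Q (a level-m lattice point). Then π(β) - π(ρ) ∈ Q_Fib, where ρ := 0 if m ≡ 0 (mod 5), ρ := -α₁ if m ≡ 1 (mod 5), ρ := α₃ if m ≡ 2 (mod 5), ρ := -α₃ if m ≡ 3 (mod 5), and ρ := α₁ if m ≡ 4 (mod 5). In particular, the coset of π(β) modulo Q_Fib depends only on m mod 5, and for β ∈ Δ_m the projection π(β) lies in the coset K_{((m+2) mod 5) - 2} with representative Λ_i = π(ρ). -/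
/-! Statement 12: the coset of π(β) modulo Q_Fib depends only on the Fib-level m mod 5,
with explicit coset representatives Λ_i = π(ρ). -/

noncomputable section

open Matrix

/-- The representative root ρ for each residue of the level m mod 5:
ρ = 0, -α₁, α₃, -α₃, α₁ for m ≡ 0, 1, 2, 3, 4 (mod 5). -/
def ρrep (m : ℤ) : Matrix (Fin 2) (Fin 2) ℝ :=
  if m % 5 = 0 then 0
  else if m % 5 = 1 then -α₁
  else if m % 5 = 2 then α₃
  else if m % 5 = 3 then -α₃
  else α₁

/-- Lattice points whose Fib-levels agree mod 5 have projections congruent modulo `QFib`. -/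
theorem proj_sub_proj_mem_QFib {b c m b' c' m' : ℤ} (h : m % 5 = m' % 5) :
    proj (sm (b + c + m) b c) - proj (sm (b' + c' + m') b' c') ∈ QFib := by
  obtain ⟨k, hk⟩ : ∃ k, m = m' + 5 * k := ⟨(m - m') / 5, by omega⟩
  subst hk
  refine ⟨-(c - c' + 2 * k), -(b - b' + k) - (c - c' + 2 * k), ?_⟩
  ext i j
  fin_cases i <;> fin_cases j <;> simp [proj, lvl, sm, β₁, β₂, α₂] <;> ring

/-- The representative `ρrep m` is a lattice point whose Fib-level is congruent to `m` mod 5. -/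
theorem exists_ρrep_eq_sm (m : ℤ) :
    ∃ b c l : ℤ, m % 5 = l % 5 ∧ ρrep m = sm (b + c + l) b c := by
  unfold ρrep
  split_ifs with h0 h1 h2 h3
  · exact ⟨0, 0, 0, by omega, by ext i j; fin_cases i <;> fin_cases j <;> simp [sm]⟩
  · exact ⟨-1, 0, 1, by omega, by ext i j; fin_cases i <;> fin_cases j <;> simp [sm, α₁]⟩
  · exact ⟨0, -1, 2, by omega, by norm_num [α₃]⟩
  · exact ⟨0, 1, -2, by omega, by
      ext i j; fin_cases i <;> fin_cases j <;> norm_num [sm, α₃]⟩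
  · exact ⟨1, 0, -1, by omega, by norm_num [α₁]⟩

/-- For every level-m lattice point β = [[b+c+m,b],[b,c]], π(β) - π(ρ) ∈ Q_Fib, where ρ
is the representative for m mod 5; in particular the coset of π(β) modulo Q_Fib depends
only on m mod 5. -/
theorem proj_coset (b c m : ℤ) :
    proj (sm (b + c + m) b c) - proj (ρrep m) ∈ QFib ∧
    (∀ b' c' m' : ℤ, m' % 5 = m % 5 →
      proj (sm (b' + c' + m') b' c') - proj (sm (b + c + m) b c) ∈ QFib) := by
  refine ⟨?_, fun b' c' m' h => proj_sub_proj_mem_QFib h⟩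
  obtain ⟨b', c', l, hl, hρ⟩ := exists_ρrep_eq_sm m
  rw [hρ]
  exact proj_sub_proj_mem_QFib hl

end
end

section
/- Let L be a Lie algebra over a commutative ring R with elements eᵢ, fᵢ, hᵢ (i in an index type ι with decidable equality) and a matrix A : ι → ι → R satisfying ⁅hᵢ, fⱼ⁆ = -A i j • fⱼ, ⁅hᵢ, eⱼ⁆ = A i j • eⱼ, and ⁅eᵢ, fⱼ⁆ = δᵢⱼ • hᵢ for all i, j. For n ≥ 2 and indices j₁,…,jₙ define the multibracket F(jₙ,…,j₁) := ⁅f_{jₙ}, ⁅f_{jₙ₋₁}, …, ⁅f_{j₂}, f_{j₁}⁆…⁆⁆, and similarly E(jₙ,…,j₁) with e's. Then for every i: ⁅eᵢ, F(jₙ,…,j₁)⁆ = δ_{i,j₁}·A j₁ j₂ • F(jₙ,…,j₂) − Σ_{m=2}^{n} δ_{i,jₘ}·(Σ_{k=1}^{m−1} A jₘ jₖ) • F(jₙ,…,ĵₘ,…,j₁), where the hat denotes omission of the m-th index; and the same formula holds with the roles of e and f interchanged: ⁅fᵢ, E(jₙ,…,j₁)⁆ = δ_{i,j₁}·A j₁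 j₂ • E(jₙ,…,j₂) − Σ_{m=2}^{n} δ_{i,jₘ}·(Σ_{k=1}^{m−1} A jₘ jₖ) • E(jₙ,…,ĵₘ,…,j₁). -/
/-! Statement 17: the multibracket theorem. For Chevalley-type generators e, f, h of a Lie
algebra over a commutative ring R, with ⁅hᵢ,fⱼ⁆ = -Aᵢⱼ•fⱼ, ⁅hᵢ,eⱼ⁆ = Aᵢⱼ•eⱼ and
⁅eᵢ,fⱼ⁆ = δᵢⱼ•hᵢ, the bracket of eᵢ against a right-nested multibracket of f's (and
symmetrically of fᵢ against a multibracket of e's) is given by the stated formula. -/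

/-- The right-nested multibracket: `multibracket f n j = ⁅f j_n, ⁅…, ⁅f j_1, f j_0⁆…⁆⁆`
for `j : Fin (n+1) → ι` (so with `n + 1` entries, the entry `j 0` innermost). -/
def multibracket {L : Type*} [LieRing L] {ι : Type*} (f : ι → L) :
    (n : ℕ) → (Fin (n + 1) → ι) → L
  | 0, j => f (j 0)
  | n + 1, j => ⁅f (j (Fin.last (n + 1))), multibracket f n fun k => j k.castSucc⁆

theorem lie_cartan_multibracket
    {R : Type*} {L : Type*} {ι : Type*} [CommRing R] [LieRing L] [LieAlgebra R L]
    (A : ι → ι → R) (f h : ι → L) (hHF : ∀ i j, ⁅h i, f j⁆ = -A i j • f j)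
    (i : ι) (n : ℕ) (j : Fin (n + 1) → ι) :
    ⁅h i, multibracket f n j⁆ = -(∑ k, A i (j k)) • multibracket f n j := by
  induction n with
  | zero => simp [multibracket, hHF]
  | succ n ih =>
    rw [multibracket, leibniz_lie, ih, hHF, Fin.sum_univ_castSucc (n := n + 1)]
    simp only [smul_lie, lie_smul]
    module

theorem Fin.sum_Iio_last {M : Type*} [AddCommMonoid M] {n : ℕ} (g : Fin (n + 1) → M) :
    ∑ k ∈ Finset.Iio (Fin.last n), g k = ∑ k : Fin n, g k.castSucc := by
  rw [Fin.Iio_last_eq_map, Finset.sum_map]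
  rfl

theorem Fin.castSucc_succAbove_last {n : ℕ} (m : Fin (n + 1)) :
    m.castSucc.succAbove (Fin.last n) = Fin.last (n + 1) :=
  Fin.succAbove_castSucc_of_le _ _ (Fin.le_last m)

/-- One half of the multibracket theorem; the other half is the same statement with `e` and `f`
interchanged and `h` replaced by `-h`. -/
theorem lie_multibracket_of_lie_eq
    {R : Type*} {L : Type*} {ι : Type*} [CommRing R] [LieRing L] [LieAlgebra R L]
    [DecidableEq ι] (A : ι → ι → R) (e f h : ι → L)
    (hHF : ∀ i j, ⁅h i, f j⁆ = -A i j • f j)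
    (hEF : ∀ i j, ⁅e i, f j⁆ = if i = j then h i else 0)
    (n : ℕ) (j : Fin (n + 2) → ι) (i : ι) :
    ⁅e i, multibracket f (n + 1) j⁆ =
      (if i = j 0 then A (j 0) (j 1) else 0) • multibracket f n (fun k => j k.succ)
        - ∑ m ∈ Finset.Ioi (0 : Fin (n + 2)),
            (if i = j m then ∑ k ∈ Finset.Iio m, A (j m) (j k) else 0) •
              multibracket f n (fun k => j (m.succAbove k)) := by
  have lie_outer (n : ℕ) (a : ι) (j : Fin (n + 1) → ι) :
      ⁅⁅e i, f a⁆, multibracket f n j⁆ =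
        -((if i = a then ∑ k, A a (j k) else 0) • multibracket f n j) := by
    rw [hEF]
    split_ifs with hi
    · rw [lie_cartan_multibracket A f h hHF, hi, neg_smul]
    · simp
  induction n with
  | zero =>
    have h_unfold : multibracket f (0 + 1) j =
        ⁅f (j 1), multibracket f 0 fun k => j k.castSucc⁆ := rfl
    rw [h_unfold, leibniz_lie, lie_outer, Fin.sum_Ioi_zero]
    have h_inner : ⁅f (j 1), ⁅e i, f (j 0)⁆⁆ =
        (if i = j 0 then A (j 0) (j 1) else 0) • f (j 1) := by
      rw [hEF]
      split_ifs with hi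
      · rw [← lie_skew, hHF, hi, neg_smul, neg_neg]
      · simp
    have h_Iio : Finset.Iio (1 : Fin 2) = {0} := rfl
    simp [multibracket, h_inner, h_Iio]
    abel
  | succ n ih =>
    rw [multibracket, leibniz_lie, ih, Fin.sum_Ioi_zero, Fin.sum_Ioi_zero,
      Fin.sum_univ_castSucc (n := n + 1), lie_outer]
    simp only [lie_sub, lie_sum, lie_smul, multibracket, Fin.succ_castSucc,
      Fin.sum_Iio_castSucc, Fin.succ_last, Fin.sum_Iio_last, Nat.succ_eq_add_one,
      Fin.castSucc_succAbove_castSucc, Fin.succAbove_last_apply,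
      Fin.castSucc_succAbove_last, Fin.castSucc_zero,
      Fin.castSucc_one]
    exact (neg_add_eq_sub _ _).trans (sub_sub _ _ _)

/-- The multibracket theorem: for a multibracket with `n + 2 ≥ 2` entries `j 0, …, j (n+1)`
(corresponding to `j₁, …, j_N` for `N = n + 2` in the paper),
⁅eᵢ, F(j_N,…,j₁)⁆ = δ_{i,j₁}·A j₁ j₂ • F(j_N,…,j₂)
  − Σ_{m=2}^{N} δ_{i,jₘ}·(Σ_{k=1}^{m−1} A jₘ jₖ) • F(j_N,…,ĵₘ,…,j₁),
and the same formula with the roles of e and f interchanged. -/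
theorem bracket_multibracket
    {R : Type*} {L : Type*} {ι : Type*} [CommRing R] [LieRing L] [LieAlgebra R L]
    [DecidableEq ι] (A : ι → ι → R) (e f h : ι → L)
    (hHE : ∀ i j, ⁅h i, e j⁆ = A i j • e j)
    (hHF : ∀ i j, ⁅h i, f j⁆ = -A i j • f j)
    (hEF : ∀ i j, ⁅e i, f j⁆ = if i = j then h i else 0)
    (n : ℕ) (j : Fin (n + 2) → ι) (i : ι) :
    (⁅e i, multibracket f (n + 1) j⁆ =
      (if i = j 0 then A (j 0) (j 1) else 0) • multibracket f n (fun k => j k.succ)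
        - ∑ m ∈ Finset.Ioi (0 : Fin (n + 2)),
            (if i = j m then ∑ k ∈ Finset.Iio m, A (j m) (j k) else 0) •
              multibracket f n (fun k => j (m.succAbove k)))
    ∧
    (⁅f i, multibracket e (n + 1) j⁆ =
      (if i = j 0 then A (j 0) (j 1) else 0) • multibracket e n (fun k => j k.succ)
        - ∑ m ∈ Finset.Ioi (0 : Fin (n + 2)),
            (if i = j m then ∑ k ∈ Finset.Iio m, A (j m) (j k) else 0) •
              multibracket e n (fun k => j (m.succAbove k))) := by
  refine ⟨lie_multibracket_of_lie_eq A e f h hHF hEF n j i,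
    lie_multibracket_of_lie_eq A f e (-h) (fun a b => ?_) (fun a b => ?_) n j i⟩
  · rw [Pi.neg_apply, neg_lie, hHE, neg_smul]
  · rw [← lie_skew, hEF]
    aesop
end
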